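/- Let A : Matrix I J ℂ and B : Matrix J K ℂ, and let M : Matrix I I ℂ, N : Matrix K K ℂ, and P : Matrix J J ℂ be Hermitian positive definite. Let XA be the weighted Moore–Penrose inverse of A with respect to (M, P), set B₁ = XA * A * B, let X₁ be the weighted Moore–Penrose inverse of B₁ with respect to (P, N), set A₁ = A * B₁ * X₁, and let Y₁ be the weighted Moore–Penrose inverse of A₁ with respect to (M, P). Then the weighted Moore–Penrose inverse of A * B with respect to (M, N) equals X₁ * Y₁. -/

import Mathlib

open Matrix
open scoped ComplexOrder

/-- `X` is a weighted Moore–Penrose inverse of `A` with respect to weights `M` and `N`. -/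
def IsWMPInv {I J : Type*} [Fintype I] [Fintype J]
    (M : Matrix I I ℂ) (N : Matrix J J ℂ)
    (A : Matrix I J ℂ) (X : Matrix J I ℂ) : Prop :=
  A * X * A = A ∧ X * A * X = X ∧
  (M * A * X)ᴴ = M * A * X ∧ (N * X * A)ᴴ = N * X * A

/-- A positive definite matrix can be cancelled on the left. -/
theorem Matrix.PosDef.mul_left_cancel {I J : Type*} [Fintype I] {M : Matrix I I ℂ}
    (hM : M.PosDef) {S T : Matrix I J ℂ} (h : M * S = M * T) : S = T := by
  classical
  have hdet : IsUnit M.det := (Matrix.isUnit_iff_isUnit_det M).1 hM.isUnit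
  rw [← Matrix.nonsing_inv_mul_cancel_left M S hdet, h,
    Matrix.nonsing_inv_mul_cancel_left M T hdet]

/-- If `S` and `T` are self-adjoint for the weight `M` and `T * S = R` with `R` self-adjoint,
then also `S * T = R`. -/
theorem mul_eq_of_weighted_selfAdjoint {I : Type*} [Fintype I] {M S T R : Matrix I I ℂ}
    (hM : M.PosDef) (hS : (M * S)ᴴ = M * S) (hT : (M * T)ᴴ = M * T)
    (hR : (M * R)ᴴ = M * R) (h : T * S = R) : S * T = R := by
  have hMh : Mᴴ = M := hM.isHermitian
  rw [conjTranspose_mul, hMh] at hS hT hR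
  apply hM.mul_left_cancel
  rw [← Matrix.mul_assoc, ← hS, Matrix.mul_assoc, ← hT, ← Matrix.mul_assoc,
    ← conjTranspose_mul, h, hR]

/-- The weighted Moore–Penrose inverse is unique. -/
theorem IsWMPInv.unique {I J : Type*} [Fintype I] [Fintype J]
    {M : Matrix I I ℂ} {N : Matrix J J ℂ} (hM : M.PosDef) (hN : N.PosDef)
    {A : Matrix I J ℂ} {X Y : Matrix J I ℂ}
    (hX : IsWMPInv M N A X) (hY : IsWMPInv M N A Y) : X = Y := by
  obtain ⟨hX₁, hX₂, hX₃, hX₄⟩ := hX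
  obtain ⟨hY₁, hY₂, hY₃, hY₄⟩ := hY
  rw [Matrix.mul_assoc] at hX₃ hX₄ hY₃ hY₄
  have hAXY : A * X = A * Y := by
    rw [← mul_eq_of_weighted_selfAdjoint hM hX₃ hY₃ hX₃ (by rw [← Matrix.mul_assoc, hY₁]),
      ← Matrix.mul_assoc, hX₁]
  have hXYA : X * A = Y * A := by
    rw [← mul_eq_of_weighted_selfAdjoint hN hX₄ hY₄ hY₄
      (by rw [Matrix.mul_assoc, ← Matrix.mul_assoc A, hX₁]),
      Matrix.mul_assoc, ← Matrix.mul_assoc A, hY₁]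
  rw [← hX₂, Matrix.mul_assoc, hAXY, ← Matrix.mul_assoc, hXYA, hY₂]

theorem wmp_product_characterization
    {I J K : Type*} [Fintype I] [Fintype J] [Fintype K]
    (A : Matrix I J ℂ) (B : Matrix J K ℂ)
    (M : Matrix I I ℂ) (N : Matrix K K ℂ) (P : Matrix J J ℂ)
    (hMh : Mᴴ = M) (hM : M.PosDef) (hNh : Nᴴ = N) (hN : N.PosDef)
    (hPh : Pᴴ = P) (hP : P.PosDef)
    (XA : Matrix J I ℂ) (hXA : IsWMPInv M P A XA)
    (B₁ : Matrix J K ℂ) (hB₁ : B₁ = XA * A * B)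
    (X₁ : Matrix K J ℂ) (hX₁ : IsWMPInv P N B₁ X₁)
    (A₁ : Matrix I J ℂ) (hA₁ : A₁ = A * B₁ * X₁)
    (Y₁ : Matrix J I ℂ) (hY₁ : IsWMPInv M P A₁ Y₁)
    (Z : Matrix K I ℂ) (hZ : IsWMPInv M N (A * B) Z) :
    Z = X₁ * Y₁ := by
  obtain ⟨hXA₁, -, -, -⟩ := hXA
  obtain ⟨hX₁₁, hX₁₂, hX₁₃, hX₁₄⟩ := hX₁
  obtain ⟨hY₁₁, hY₁₂, hY₁₃, hY₁₄⟩ := hY₁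
  have hAB : A * B₁ = A * B := by
    rw [hB₁, ← Matrix.mul_assoc, ← Matrix.mul_assoc, hXA₁]
  have hXAB : XA * (A * B₁) = B₁ := by rw [hAB, ← Matrix.mul_assoc, ← hB₁]
  have hA₁B₁ : A₁ * B₁ = A * B := by
    rw [hA₁, Matrix.mul_assoc A, Matrix.mul_assoc A, hX₁₁, hAB]
  have hABX : A * B * X₁ = A₁ := by rw [← hAB, ← hA₁]
  have hXAA₁ : XA * A₁ = B₁ * X₁ := by rw [hA₁, ← Matrix.mul_assoc, hXAB]
  rw [Matrix.mul_assoc] at hX₁₃ hY₁₄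
  -- The projections `Y₁ * A₁` and `B₁ * X₁` agree, since `A₁` and `B₁ * X₁` have the same kernel.
  have hproj : Y₁ * A₁ = B₁ * X₁ := by
    rw [← mul_eq_of_weighted_selfAdjoint hP hX₁₃ hY₁₄ hY₁₄
      (by rw [Matrix.mul_assoc, ← Matrix.mul_assoc A₁, hA₁B₁, hABX]),
      ← hXAA₁, Matrix.mul_assoc, ← Matrix.mul_assoc A₁, hY₁₁]
  have hright : A * B * (X₁ * Y₁) = A₁ * Y₁ := by rw [← Matrix.mul_assoc, hABX]
  have hleft : X₁ * Y₁ * (A * B) = X₁ * B₁ := by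
    rw [← hA₁B₁, Matrix.mul_assoc, ← Matrix.mul_assoc Y₁, hproj, hX₁₁]
  refine hZ.unique hM hN ⟨?_, ?_, ?_, ?_⟩
  · rw [hright, ← hA₁B₁, ← Matrix.mul_assoc, hY₁₁]
  · rw [hleft, ← Matrix.mul_assoc, hX₁₂]
  · rwa [Matrix.mul_assoc, hright, ← Matrix.mul_assoc]
  · rwa [Matrix.mul_assoc, hleft, ← Matrix.mul_assoc]
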